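/- Let f : X → Y be an initial map (the topology of X is the topology induced by f from Y, i.e. every open subset of X is of the form f⁻¹(V) for some open V ⊆ Y) into a Noetherian space Y. Then: (1) X is Noetherian; (2) ||X|| ≤ ||Y||; (3) if f is also continuous, then sob X ≤ sob Y; (4) if f is continuous, initial and Skula dense (the preimage map on closed sets is injective), then ||X|| = ||Y|| and sob X = sob Y. -/

import Mathlib

open TopologicalSpace

/-- The ordinal rank of an element of a poset: defined by well-founded recursion as the least
ordinal strictly greater than the ranks of all strictly smaller elements (and `0` as a junk
value if the strict order is not well-founded). -/
noncomputable def wfRank {α : Type*} [Preorder α] (a : α) : Ordinal :=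
  open Classical in
  if h : WellFoundedLT α then @IsWellFounded.rank α (· < ·) h a else 0

/-- The ordinal rank of a poset: the least ordinal strictly greater than the ranks of
all its elements. -/
noncomputable def ordRank (α : Type*) [Preorder α] : Ordinal :=
  ⨆ a : α, wfRank a + 1

/-- The stature of a topological space: the rank of the whole space in the poset of
closed subsets ordered by inclusion (equivalently, the ordinal rank of the poset of proper
closed subsets). -/
noncomputable def stature (X : Type*) [TopologicalSpace X] : Ordinal :=
  wfRank (⊤ : Closeds X)

/-- The sobrification rank of a topological space: the ordinal rank of the poset of
irreducible closed subsets ordered by inclusion. -/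
noncomputable def sobRank (X : Type*) [TopologicalSpace X] : Ordinal :=
  ordRank (IrreducibleCloseds X)

section Rank

variable {α β : Type u} [Preorder α] [Preorder β]

lemma wfRank_strictMono [WellFoundedLT α] : StrictMono (wfRank : α → Ordinal) := by
  intro a b h
  simpa only [wfRank, dif_pos (inferInstance : WellFoundedLT α)] using
    WellFoundedLT.rank_strictMono h

lemma wfRank_le_of_forall_lt [WellFoundedLT α] {a : α} {o : Ordinal}
    (h : ∀ b < a, wfRank b < o) : wfRank a ≤ o := by
  simp only [wfRank, dif_pos (inferInstance : WellFoundedLT α)] at h ⊢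
  rw [IsWellFounded.rank_eq]
  exact Ordinal.iSup_le fun b => Order.succ_le_of_lt (h b b.2)

lemma StrictMono.wfRank_le [WellFoundedLT β] {φ : α → β} (hφ : StrictMono φ) (a : α) :
    wfRank a ≤ wfRank (φ a) := by
  have : WellFoundedLT α := hφ.wellFoundedLT
  induction a using WellFoundedLT.induction with
  | ind a ih =>
    exact wfRank_le_of_forall_lt fun b hb => (ih b hb).trans_lt (wfRank_strictMono (hφ hb))

lemma StrictMono.ordRank_le [WellFoundedLT β] {φ : α → β} (hφ : StrictMono φ) :
    ordRank α ≤ ordRank β :=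
  Ordinal.iSup_le fun a => (add_le_add_left (hφ.wfRank_le a) 1).trans
    (Ordinal.le_iSup (fun b : β => wfRank b + 1) (φ a))

end Rank

section Initial

variable {X Y : Type*} [TopologicalSpace X] [TopologicalSpace Y] {f : X → Y}

lemma exists_isClosed_eq_preimage
    (hinit : ∀ U : Set X, IsOpen U → ∃ V : Set Y, IsOpen V ∧ U = f ⁻¹' V)
    {F : Set X} (hF : IsClosed F) : ∃ C : Set Y, IsClosed C ∧ F = f ⁻¹' C := by
  obtain ⟨V, hV, h⟩ := hinit Fᶜ hF.isOpen_compl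
  exact ⟨Vᶜ, hV.isClosed_compl, by rw [Set.preimage_compl, ← h, compl_compl]⟩

lemma preimage_closure_image_eq
    (hinit : ∀ U : Set X, IsOpen U → ∃ V : Set Y, IsOpen V ∧ U = f ⁻¹' V)
    {F : Set X} (hF : IsClosed F) : f ⁻¹' closure (f '' F) = F := by
  obtain ⟨C, hC, rfl⟩ := exists_isClosed_eq_preimage hinit hF
  exact (Set.preimage_mono (closure_minimal (Set.image_preimage_subset f C) hC)).antisymm
    (Set.image_subset_iff.1 subset_closure)

/-- For an initial map, taking the closure of the image is strictly monotone on closed sets. -/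
lemma closure_image_strictMono
    (hinit : ∀ U : Set X, IsOpen U → ∃ V : Set Y, IsOpen V ∧ U = f ⁻¹' V) :
    StrictMono fun F : Closeds X => Closeds.closure (f '' (F : Set X)) := by
  refine Monotone.strictMono_of_injective
    (fun F G h => SetLike.coe_subset_coe.1 (closure_mono (Set.image_mono h))) fun F G h => ?_
  have h' : closure (f '' (F : Set X)) = closure (f '' (G : Set X)) :=
    congrArg ((↑) : Closeds Y → Set Y) h
  apply SetLike.coe_injective
  rw [← preimage_closure_image_eq hinit F.isClosed, h',
    preimage_closure_image_eq hinit G.isClosed]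

/-- For a continuous initial map, taking the closure of the image is strictly monotone on
irreducible closed sets. -/
lemma closure_image_irreducible_strictMono
    (hinit : ∀ U : Set X, IsOpen U → ∃ V : Set Y, IsOpen V ∧ U = f ⁻¹' V)
    (hf : Continuous f) :
    StrictMono fun F : IrreducibleCloseds X =>
      (⟨closure (f '' (F : Set X)), (F.isIrreducible.image f hf.continuousOn).closure,
        isClosed_closure⟩ : IrreducibleCloseds Y) := by
  refine Monotone.strictMono_of_injective
    (fun F G h => SetLike.coe_subset_coe.1 (closure_mono (Set.image_mono h))) fun F G h => ?_
  have h' : closure (f '' (F : Set X)) = closure (f '' (G : Set X)) :=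
    congrArg ((↑) : IrreducibleCloseds Y → Set Y) h
  apply SetLike.coe_injective
  rw [← preimage_closure_image_eq hinit F.isClosed, h',
    preimage_closure_image_eq hinit G.isClosed]

lemma preimage_closeds_strictMono (hf : Continuous f)
    (hinj : ∀ F G : Set Y, IsClosed F → IsClosed G → f ⁻¹' F = f ⁻¹' G → F = G) :
    StrictMono (Closeds.preimage · hf) := by
  refine Monotone.strictMono_of_injective
    (fun F G h _ hx => h hx) fun F G h => ?_
  exact SetLike.coe_injective (hinj F G F.isClosed G.isClosed
    (congrArg ((↑) : Closeds X → Set X) h))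

/-- The preimage of an irreducible closed set under a Skula dense initial map is irreducible. -/
lemma IsIrreducible.preimage_of_isClosed
    (hinit : ∀ U : Set X, IsOpen U → ∃ V : Set Y, IsOpen V ∧ U = f ⁻¹' V)
    (hinj : ∀ F G : Set Y, IsClosed F → IsClosed G → f ⁻¹' F = f ⁻¹' G → F = G)
    {G : Set Y} (hG : IsIrreducible G) (hGc : IsClosed G) : IsIrreducible (f ⁻¹' G) := by
  refine ⟨Set.nonempty_iff_ne_empty.2 fun h => hG.nonempty.ne_empty
    (hinj G ∅ hGc isClosed_empty (by rw [h, Set.preimage_empty])), ?_⟩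
  rw [isPreirreducible_iff_isClosed_union_isClosed]
  intro F₁ F₂ hF₁ hF₂ h
  obtain ⟨C₁, hC₁, rfl⟩ := exists_isClosed_eq_preimage hinit hF₁
  obtain ⟨C₂, hC₂, rfl⟩ := exists_isClosed_eq_preimage hinit hF₂
  have hGC : G ∩ (C₁ ∪ C₂) = G := hinj _ _ (hGc.inter (hC₁.union hC₂)) hGc (by
    rw [Set.preimage_inter, Set.preimage_union, Set.inter_eq_left]
    exact h)
  exact (isPreirreducible_iff_isClosed_union_isClosed.1 hG.isPreirreducible C₁ C₂ hC₁ hC₂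
    (Set.inter_eq_left.1 hGC)).imp (Set.preimage_mono ·) (Set.preimage_mono ·)

lemma preimage_irreducibleCloseds_strictMono
    (hinit : ∀ U : Set X, IsOpen U → ∃ V : Set Y, IsOpen V ∧ U = f ⁻¹' V) (hf : Continuous f)
    (hinj : ∀ F G : Set Y, IsClosed F → IsClosed G → f ⁻¹' F = f ⁻¹' G → F = G) :
    StrictMono fun G : IrreducibleCloseds Y =>
      (⟨f ⁻¹' G, G.isIrreducible.preimage_of_isClosed hinit hinj G.isClosed,
        G.isClosed.preimage hf⟩ : IrreducibleCloseds X) := by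
  refine Monotone.strictMono_of_injective
    (fun F G h _ hx => h hx) fun F G h => ?_
  exact SetLike.coe_injective (hinj F G F.isClosed G.isClosed
    (congrArg ((↑) : IrreducibleCloseds X → Set X) h))

end Initial

lemma noetherianSpace_iff_wellFoundedLT_closeds {X : Type*} [TopologicalSpace X] :
    NoetherianSpace X ↔ WellFoundedLT (Closeds X) :=
  (noetherianSpace_TFAE X).out 0 1

lemma wellFoundedLT_irreducibleCloseds (X : Type*) [TopologicalSpace X] [NoetherianSpace X] :
    WellFoundedLT (IrreducibleCloseds X) :=
  have := noetherianSpace_iff_wellFoundedLT_closeds.1 (inferInstance : NoetherianSpace X)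
  StrictMono.wellFoundedLT (β := Closeds X)
    (f := fun F : IrreducibleCloseds X => ⟨F, F.isClosed⟩) fun _ _ h => h

/-- Let `f : X → Y` be an initial map (every open of `X` is `f ⁻¹' V` for some open
`V ⊆ Y`) into a Noetherian space `Y`. Then (1) `X` is Noetherian; (2) `‖X‖ ≤ ‖Y‖`;
(3) if `f` is continuous, `sob X ≤ sob Y`; (4) if `f` is moreover Skula dense (preimage is
injective on closed sets), then `‖X‖ = ‖Y‖` and `sob X = sob Y`. -/
theorem noetherian_of_initial (X Y : Type u) [TopologicalSpace X] [TopologicalSpace Y]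
    [NoetherianSpace Y] (f : X → Y)
    (hinit : ∀ U : Set X, IsOpen U → ∃ V : Set Y, IsOpen V ∧ U = f ⁻¹' V) :
    NoetherianSpace X ∧
    stature X ≤ stature Y ∧
    (Continuous f → sobRank X ≤ sobRank Y) ∧
    (Continuous f →
      (∀ F G : Set Y, IsClosed F → IsClosed G → f ⁻¹' F = f ⁻¹' G → F = G) →
      stature X = stature Y ∧ sobRank X = sobRank Y) := by
  have hwY : WellFoundedLT (Closeds Y) := noetherianSpace_iff_wellFoundedLT_closeds.1 inferInstance
  have hiY := wellFoundedLT_irreducibleCloseds Y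
  have hmono := closure_image_strictMono hinit
  have hwX : WellFoundedLT (Closeds X) := hmono.wellFoundedLT
  have hX : NoetherianSpace X := noetherianSpace_iff_wellFoundedLT_closeds.2 hwX
  have hiX := wellFoundedLT_irreducibleCloseds X
  have hstature : stature X ≤ stature Y :=
    (hmono.wfRank_le ⊤).trans (wfRank_strictMono.monotone le_top)
  have hsob (hf : Continuous f) : sobRank X ≤ sobRank Y :=
    (closure_image_irreducible_strictMono hinit hf).ordRank_le
  refine ⟨hX, hstature, hsob, fun hf hinj => ⟨hstature.antisymm ?_, (hsob hf).antisymm ?_⟩⟩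
  · exact ((preimage_closeds_strictMono hf hinj).wfRank_le ⊤).trans
      (wfRank_strictMono.monotone le_top)
  · exact (preimage_irreducibleCloseds_strictMono hinit hf hinj).ordRank_le
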